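/- In the configuration Γ^D, for every measurable f : Γ^D → ℝ, integrable on every bounded measurable subset of Γ^D, with |f|_{Ḣ^{1/2}(Γ^D)} < ∞, and for every ε > 0, there exists an infinitely differentiable function φ : ℝ → ℝ with compact support contained in the open set Γ^D = ⋃_j E_j such that |f − φ|_{Ḣ^{1/2}(Γ^D)} < ε. -/

import Mathlib

open MeasureTheory Set Filter
open scoped ENNReal BigOperators

noncomputable def screenedSeminorm (I : Set ℝ) (r : ℝ) (f : ℝ → ℝ) : ℝ≥0∞ :=
  (∫⁻ x in I, ∫⁻ y in I ∩ Set.Ioo (x - r) (x + r),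
      ENNReal.ofReal ((f y - f x) ^ 2 / (y - x) ^ 2)) ^ (1 / 2 : ℝ)

def LocIntOn (I : Set ℝ) (f : ℝ → ℝ) : Prop :=
  ∀ s : Set ℝ, s ⊆ I → MeasurableSet s → Bornology.IsBounded s →
    MeasureTheory.IntegrableOn f s

noncomputable def avgOn (J : Set ℝ) (f : ℝ → ℝ) : ℝ :=
  (MeasureTheory.volume J).toReal⁻¹ * ∫ x in J, f x

/-- The configuration `Γ^D`: `N + 1` nonempty open intervals `E 0, …, E N` listed in
increasing order and separated by gaps of positive length, all bounded except that `E 0`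
may be a half-line unbounded to the left and `E N` a half-line unbounded to the right,
together with bounded averaging windows `I j ⊆ E j` (with `I j = E j` when `E j` is bounded). -/
structure GammaConfig (N : ℕ) where
  hN : 1 ≤ N
  E : Fin (N + 1) → Set ℝ
  I : Fin (N + 1) → Set ℝ
  hE : ∀ j, (∃ a b : ℝ, a < b ∧ E j = Set.Ioo a b) ∨
      (j = 0 ∧ ∃ b : ℝ, E j = Set.Iio b) ∨
      (j = Fin.last N ∧ ∃ a : ℝ, E j = Set.Ioi a)
  hsep : ∀ j : Fin N, ∃ c d : ℝ, c < d ∧ (∀ x ∈ E j.castSucc, x ≤ c) ∧ ∀ y ∈ E j.succ, d ≤ y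
  hIsub : ∀ j, I j ⊆ E j
  hIint : ∀ j, ∃ a b : ℝ, a < b ∧ I j = Set.Ioo a b
  hIeq : ∀ j, Bornology.IsBounded (E j) → I j = E j

/-- The union `Γ^D = ⋃ j, E j`. -/
def GammaConfig.Gamma {N : ℕ} (cfg : GammaConfig N) : Set ℝ := ⋃ j, cfg.E j

/-- The seminorm `|f|_{Ḣ^{1/2}(Γ^D)}`, including the nonlocal terms linking the
connected components. -/
noncomputable def GammaConfig.seminorm {N : ℕ} (cfg : GammaConfig N) (f : ℝ → ℝ) : ℝ≥0∞ :=
  (∑ j : Fin (N + 1), screenedSeminorm (cfg.E j) 1 f) +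
    ∑ j : Fin N, ENNReal.ofReal |avgOn (cfg.I j.succ) f - avgOn (cfg.I j.castSucc) f|

/-- The difference quotient `(u y - u x) / (y - x)` as a function of the pair `(x, y)`. -/
noncomputable def diffQuot (u : ℝ → ℝ) (p : ℝ × ℝ) : ℝ := (u p.2 - u p.1) / (p.2 - p.1)

/-- The pairs of points of `E` at distance less than one. -/
def strip (E : Set ℝ) : Set (ℝ × ℝ) := {p | p.1 ∈ E ∧ p.2 ∈ E ∧ |p.2 - p.1| < 1}

theorem measurableSet_strip {E : Set ℝ} (hE : MeasurableSet E) : MeasurableSet (strip E) := by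
  refine (measurable_fst hE).inter ((measurable_snd hE).inter ?_)
  exact measurableSet_lt (f := fun p : ℝ × ℝ => |p.2 - p.1|) (by fun_prop) measurable_const

theorem measurable_diffQuot {u : ℝ → ℝ} (hu : Measurable u) : Measurable (diffQuot u) := by
  unfold diffQuot; fun_prop

theorem diffQuot_sub (u v : ℝ → ℝ) :
    diffQuot (fun x => u x - v x) = diffQuot u - diffQuot v := by
  ext p; simp only [diffQuot, Pi.sub_apply]; ring

theorem diffQuot_add (u v : ℝ → ℝ) :
    diffQuot (fun x => u x + v x) = diffQuot u + diffQuot v := by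
  ext p; simp only [diffQuot, Pi.add_apply]; ring

theorem enorm_sq_eq_ofReal (a : ℝ) : ‖a‖ₑ ^ 2 = ENNReal.ofReal (a ^ 2) := by
  rw [← ofReal_norm, ← ENNReal.ofReal_pow (norm_nonneg _), Real.norm_eq_abs, sq_abs]

theorem eLpNorm_two_eq {α : Type*} [MeasurableSpace α] {μ : Measure α} (F : α → ℝ) :
    eLpNorm F 2 μ = (∫⁻ x, ‖F x‖ₑ ^ 2 ∂μ) ^ (1 / 2 : ℝ) := by
  rw [eLpNorm_eq_lintegral_rpow_enorm_toReal (by norm_num) (by norm_num)]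
  simp

theorem screenedSeminorm_eq_eLpNorm {E : Set ℝ} (hE : MeasurableSet E) {u : ℝ → ℝ}
    (hu : Measurable u) :
    screenedSeminorm E 1 u = eLpNorm (diffQuot u) 2 ((volume : Measure (ℝ × ℝ)).restrict (strip E)) := by
  have hm : Measurable fun p => ‖diffQuot u p‖ₑ ^ 2 :=
    (measurable_diffQuot hu).enorm.pow_const 2
  rw [eLpNorm_two_eq, screenedSeminorm, ← lintegral_indicator (measurableSet_strip hE),
    Measure.volume_eq_prod, lintegral_prod _ (hm.indicator (measurableSet_strip hE)).aemeasurable,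
    ← lintegral_indicator hE]
  congr 2
  ext x
  by_cases hx : x ∈ E
  · rw [indicator_of_mem hx, ← lintegral_indicator (hE.inter measurableSet_Ioo)]
    congr 1
    ext y
    have : y ∈ E ∩ Ioo (x - 1) (x + 1) ↔ (x, y) ∈ strip E := by
      simp only [strip, mem_inter_iff, mem_Ioo, mem_ofPred_eq, hx, true_and, abs_lt]
      constructor <;> rintro ⟨h, h1, h2⟩ <;> refine ⟨h, ?_, ?_⟩ <;> linarith
    by_cases hy : y ∈ E ∩ Ioo (x - 1) (x + 1)
    · rw [indicator_of_mem hy, indicator_of_mem (this.1 hy), enorm_sq_eq_ofReal, diffQuot, div_pow]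
    · rw [indicator_of_notMem hy, indicator_of_notMem (this.not.1 hy)]
  · rw [indicator_of_notMem hx]
    symm
    rw [lintegral_eq_zero_iff' (by
      exact ((hm.indicator (measurableSet_strip hE)).comp (measurable_prodMk_left)).aemeasurable)]
    refine Eventually.of_forall fun y => indicator_of_notMem (fun h => hx h.1) _

theorem screenedSeminorm_congr_ae {E : Set ℝ} {u v : ℝ → ℝ}
    (huv : u =ᵐ[volume.restrict E] v) (r : ℝ) :
    screenedSeminorm E r u = screenedSeminorm E r v := by
  unfold screenedSeminorm
  congr 1
  refine lintegral_congr_ae ?_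
  filter_upwards [huv] with x hx
  refine lintegral_congr_ae ?_
  filter_upwards [ae_restrict_of_ae_restrict_of_subset inter_subset_left huv] with y hy
  rw [hx, hy]

theorem tendsto_eLpNorm_sub_of_dominated {α : Type*} [MeasurableSpace α] {μ : Measure α}
    {p : ℝ≥0∞} (hp0 : p ≠ 0) (hp : p ≠ ⊤) {F : ℕ → α → ℝ} {G : α → ℝ}
    (hF : ∀ n, AEStronglyMeasurable (F n) μ) (hG : MemLp G p μ)
    (hFG : ∀ n, ∀ᵐ x ∂μ, ‖F n x‖ ≤ ‖G x‖)
    (hlim : ∀ᵐ x ∂μ, Tendsto (fun n => F n x) atTop (nhds 0)) :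
    Tendsto (fun n => eLpNorm (F n) p μ) atTop (nhds 0) := by
  have hpos : 0 < p.toReal := ENNReal.toReal_pos hp0 hp
  simp_rw [eLpNorm_eq_lintegral_rpow_enorm_toReal hp0 hp]
  have key : Tendsto (fun n => ∫⁻ x, ‖F n x‖ₑ ^ p.toReal ∂μ) atTop (nhds (∫⁻ _, 0 ∂μ)) := by
    refine tendsto_lintegral_of_dominated_convergence' (fun x => ‖G x‖ₑ ^ p.toReal)
      (fun n => (hF n).enorm.pow_const _) (fun n => ?_) ?_ ?_
    · filter_upwards [hFG n] with x hx
      exact ENNReal.rpow_le_rpow (enorm_le_iff_norm_le.2 hx) hpos.le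
    · exact (lintegral_rpow_enorm_lt_top_of_eLpNorm_lt_top hp0 hp hG.eLpNorm_lt_top).ne
    · filter_upwards [hlim] with x hx
      have := ((ENNReal.continuous_rpow_const (y := p.toReal)).tendsto _).comp
        ((continuous_enorm.tendsto _).comp hx)
      simpa [Function.comp_def, hpos] using this
  have := ((ENNReal.continuous_rpow_const (y := 1 / p.toReal)).tendsto _).comp key
  simpa [Function.comp_def, hpos] using this

theorem tendsto_eLpNorm_translate_sub {G : Type*} [AddGroup G] [TopologicalSpace G]
    [IsTopologicalAddGroup G] [MeasurableSpace G] [BorelSpace G] {μ : Measure G}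
    [IsLocallyFiniteMeasure μ] [μ.InnerRegularCompactLTTop] [μ.IsAddLeftInvariant]
    {p : ℝ≥0∞} [Fact (1 ≤ p)] [Fact (p ≠ ⊤)] {F : G → ℝ} (hF : MemLp F p μ) :
    Tendsto (fun c => eLpNorm (fun x => F (c + x) - F x) p μ) (nhds 0) (nhds 0) := by
  have h : Continuous fun c : G => DomAddAct.mk c +ᵥ hF.toLp F :=
    (DomAddAct.continuous_mk.vadd continuous_const)
  have h2 := (h.edist (continuous_const (y := hF.toLp F))).tendsto 0
  have e : ∀ c : G, edist (DomAddAct.mk c +ᵥ hF.toLp F) (hF.toLp F) =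
      eLpNorm (fun x => F (c + x) - F x) p μ := by
    intro c
    rw [DomAddAct.mk_vadd_toLp, Lp.edist_toLp_toLp]
    rfl
  simp only [e] at h2
  simpa using h2

/-- A function tending to `∞` at both ends of `(0, ∞)`, of finite `Ḣ^{1/2}` energy. -/
noncomputable def logLog (x : ℝ) : ℝ := Real.log (1 + |Real.log x|)

theorem measurable_logLog : Measurable logLog := by
  unfold logLog; fun_prop

theorem logLog_nonneg (x : ℝ) : 0 ≤ logLog x :=
  Real.log_nonneg (by linarith [abs_nonneg (Real.log x)])

theorem abs_log_one_add_sub_le {a b : ℝ} (hb : 0 ≤ b) (hab : b ≤ a) :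
    |Real.log (1 + a) - Real.log (1 + b)| ≤ (a - b) / (1 + b) := by
  rw [abs_of_nonneg (sub_nonneg.2 (Real.log_le_log (by linarith) (by linarith))),
    ← Real.log_div (by linarith) (by linarith)]
  refine (Real.log_le_sub_one_of_pos (div_pos (by linarith) (by linarith))).trans (le_of_eq ?_)
  field_simp
  ring

theorem log_sub_log_sq_le {x y : ℝ} (hx : 0 < x) (hxy : x < y) :
    (Real.log y - Real.log x) ^ 2 / (y - x) ^ 2 ≤
      16 * x ^ (-1 / 2 : ℝ) * y ^ (-3 / 2 : ℝ) := by
  have hy : 0 < y := hx.trans hxy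
  obtain ⟨a, ha, rfl⟩ : ∃ a : ℝ, 0 < a ∧ x = a ^ 4 :=
    ⟨x ^ (1 / 4 : ℝ), by positivity, by rw [← Real.rpow_mul_natCast hx.le]; norm_num⟩
  obtain ⟨b, hb, rfl⟩ : ∃ a : ℝ, 0 < a ∧ y = a ^ 4 :=
    ⟨y ^ (1 / 4 : ℝ), by positivity, by rw [← Real.rpow_mul_natCast hy.le]; norm_num⟩
  have hab : a < b := lt_of_pow_lt_pow_left₀ 4 hb.le hxy
  have e1 : (a ^ 4) ^ (-1 / 2 : ℝ) = (a ^ 2)⁻¹ := by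
    rw [← Real.rpow_natCast a 4, ← Real.rpow_mul ha.le, ← Real.rpow_natCast a 2,
      ← Real.rpow_neg ha.le]
    norm_num
  have e2 : (b ^ 4) ^ (-3 / 2 : ℝ) = (b ^ 6)⁻¹ := by
    rw [← Real.rpow_natCast b 4, ← Real.rpow_mul hb.le, ← Real.rpow_natCast b 6,
      ← Real.rpow_neg hb.le]
    norm_num
  rw [e1, e2, div_le_iff₀ (by nlinarith [sub_pos.2 hxy]), Real.log_pow, Real.log_pow]
  have h0 : 0 ≤ Real.log b - Real.log a := sub_nonneg.2 (Real.log_le_log ha hab.le)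
  have h1 : Real.log b - Real.log a ≤ b / a - 1 := by
    rw [← Real.log_div hb.ne' ha.ne']
    exact Real.log_le_sub_one_of_pos (by positivity)
  have h2 : b / a - 1 ≤ (a * b ^ 3)⁻¹ * (b ^ 4 - a ^ 4) := by
    rw [inv_mul_eq_div, le_div_iff₀ (by positivity)]
    have : (b / a - 1) * (a * b ^ 3) = b ^ 4 - a * b ^ 3 := by field_simp
    rw [this]
    have := pow_le_pow_left₀ ha.le hab.le 3
    nlinarith
  have h3 := pow_le_pow_left₀ h0 (h1.trans h2) 2
  calc ((4 : ℕ) * Real.log b - (4 : ℕ) * Real.log a) ^ 2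
      = 16 * (Real.log b - Real.log a) ^ 2 := by push_cast; ring
    _ ≤ 16 * ((a * b ^ 3)⁻¹ * (b ^ 4 - a ^ 4)) ^ 2 := by linarith
    _ = _ := by field_simp

/-- The weight controlling the increments of `logLog` by those of `log`. -/
noncomputable def logWeight (x : ℝ) : ℝ := ((1 + |Real.log x|) ^ 2)⁻¹

theorem logWeight_nonneg (x : ℝ) : 0 ≤ logWeight x := by unfold logWeight; positivity

theorem measurable_logWeight : Measurable logWeight := by unfold logWeight; fun_prop

/-- The part above the diagonal of a kernel dominating the squared difference quotients
of `log`. -/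
noncomputable def logKernel (p : ℝ × ℝ) : ℝ :=
  {p : ℝ × ℝ | p.1 < p.2}.indicator
    (fun p => 16 * p.1 ^ (-1 / 2 : ℝ) * p.2 ^ (-3 / 2 : ℝ)) p

theorem measurable_logKernel : Measurable logKernel := by
  unfold logKernel
  exact Measurable.indicator (by fun_prop) (measurableSet_lt measurable_fst measurable_snd)

theorem logKernel_nonneg {p : ℝ × ℝ} (h1 : 0 < p.1) (h2 : 0 < p.2) : 0 ≤ logKernel p :=
  indicator_apply_nonneg fun _ => by positivity

theorem logLog_sub_sq_le {x y : ℝ} :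
    (logLog y - logLog x) ^ 2 ≤
      (Real.log y - Real.log x) ^ 2 * (logWeight x + logWeight y) := by
  have key : ∀ a b : ℝ, |b| ≤ |a| →
      (Real.log (1 + |a|) - Real.log (1 + |b|)) ^ 2 ≤ (a - b) ^ 2 * ((1 + |b|) ^ 2)⁻¹ := by
    intro a b hab
    rw [← sq_abs, ← div_eq_mul_inv, ← sq_abs (a - b), ← div_pow]
    refine pow_le_pow_left₀ (abs_nonneg _)
      ((abs_log_one_add_sub_le (abs_nonneg b) hab).trans ?_) 2
    gcongr
    exact abs_sub_abs_le_abs_sub a b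
  have n1 := logWeight_nonneg x
  have n2 := logWeight_nonneg y
  have n3 := sq_nonneg (Real.log y - Real.log x)
  rcases le_total |Real.log x| |Real.log y| with h | h
  · refine (key _ _ h).trans ?_
    rw [mul_add]
    exact le_add_of_nonneg_right (by positivity)
  · have := key _ _ h
    rw [mul_add, ← neg_sub (logLog x), neg_sq, ← neg_sub (Real.log x), neg_sq]
    refine this.trans ?_
    exact le_add_of_nonneg_left (by positivity)

theorem diffQuot_logLog_sq_le {x y : ℝ} (hx : 0 < x) (hxy : x < y) :
    diffQuot logLog (x, y) ^ 2 ≤ logKernel (x, y) * (logWeight x + logWeight y) := by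
  have hK : logKernel (x, y) = 16 * x ^ (-1 / 2 : ℝ) * y ^ (-3 / 2 : ℝ) :=
    indicator_of_mem (s := {p : ℝ × ℝ | p.1 < p.2}) hxy _
  rw [hK, diffQuot, div_pow]
  have n := add_nonneg (logWeight_nonneg x) (logWeight_nonneg y)
  calc (logLog y - logLog x) ^ 2 / (y - x) ^ 2
      ≤ (Real.log y - Real.log x) ^ 2 * (logWeight x + logWeight y) / (y - x) ^ 2 := by
        gcongr; exact logLog_sub_sq_le
    _ = (Real.log y - Real.log x) ^ 2 / (y - x) ^ 2 * (logWeight x + logWeight y) := by ring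
    _ ≤ _ := by gcongr; exact log_sub_log_sq_le hx hxy

theorem diffQuot_swap (u : ℝ → ℝ) (p : ℝ × ℝ) : diffQuot u p.swap = diffQuot u p := by
  simp only [diffQuot, Prod.fst_swap, Prod.snd_swap]
  rw [← neg_sub, ← neg_sub p.2, neg_div_neg_eq]

theorem lintegral_logKernel_right {x : ℝ} (hx : 0 < x) :
    ∫⁻ y in Ioi 0, ENNReal.ofReal (logKernel (x, y)) = ENNReal.ofReal (32 * x⁻¹) := by
  have e : ∀ y, ENNReal.ofReal (logKernel (x, y)) = (Ioi x).indicator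
      (fun y => ENNReal.ofReal (16 * x ^ (-1 / 2 : ℝ) * y ^ (-3 / 2 : ℝ))) y := by
    intro y
    by_cases h : x < y
    · rw [indicator_of_mem (by exact h), logKernel, indicator_of_mem (by exact h)]
    · rw [indicator_of_notMem (by exact h), logKernel, indicator_of_notMem (by exact h),
        ENNReal.ofReal_zero]
  simp_rw [e]
  rw [lintegral_indicator measurableSet_Ioi, Measure.restrict_restrict measurableSet_Ioi,
    inter_eq_left.2 (Ioi_subset_Ioi hx.le), ← ofReal_integral_eq_lintegral_ofReal, integral_const_mul,
    integral_Ioi_rpow_of_lt (by norm_num) hx]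
  · congr 1
    have : x⁻¹ = x ^ (-1 / 2 : ℝ) * x ^ (-3 / 2 + 1 : ℝ) := by
      rw [← Real.rpow_add hx, ← Real.rpow_neg_one]; norm_num
    rw [this]; ring
  · exact (integrableOn_Ioi_rpow_of_lt (by norm_num) hx).const_mul _
  · filter_upwards [ae_restrict_mem measurableSet_Ioi] with y hy
    have : 0 < y := hx.trans hy
    simp only [Pi.zero_apply]; positivity

theorem lintegral_logKernel_left {y : ℝ} (hy : 0 < y) :
    ∫⁻ x in Ioi 0, ENNReal.ofReal (logKernel (x, y)) = ENNReal.ofReal (32 * y⁻¹) := by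
  have e : ∀ x, ENNReal.ofReal (logKernel (x, y)) = (Iio y).indicator
      (fun x => ENNReal.ofReal (16 * y ^ (-3 / 2 : ℝ) * x ^ (-1 / 2 : ℝ))) x := by
    intro x
    by_cases h : x < y
    · rw [indicator_of_mem (by exact h), logKernel, indicator_of_mem (by exact h)]
      congr 1; ring
    · rw [indicator_of_notMem (by exact h), logKernel, indicator_of_notMem (by exact h),
        ENNReal.ofReal_zero]
  simp_rw [e]
  have hi : IntegrableOn (fun x : ℝ => x ^ (-1 / 2 : ℝ)) (Ioo 0 y) :=
    (intervalIntegral.intervalIntegrable_rpow' (r := -1 / 2) (by norm_num)).1.mono_set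
      Ioo_subset_Ioc_self
  rw [lintegral_indicator measurableSet_Iio, Measure.restrict_restrict measurableSet_Iio,
    inter_comm, Ioi_inter_Iio, ← ofReal_integral_eq_lintegral_ofReal, integral_const_mul,
    ← integral_Ioc_eq_integral_Ioo, ← intervalIntegral.integral_of_le hy.le,
    integral_rpow (Or.inl (by norm_num))]
  · congr 1
    have : y⁻¹ = y ^ (-3 / 2 : ℝ) * y ^ (-1 / 2 + 1 : ℝ) := by
      rw [← Real.rpow_add hy, ← Real.rpow_neg_one]; norm_num
    rw [this, Real.zero_rpow (by norm_num)]; ring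
  · exact hi.const_mul _
  · filter_upwards [ae_restrict_mem measurableSet_Ioo] with x hx
    have : 0 < x := hx.1
    simp only [Pi.zero_apply]; positivity

theorem lintegral_logWeight_mul_inv_lt_top :
    ∫⁻ x in Ioi 0, ENNReal.ofReal (logWeight x) * ENNReal.ofReal (32 * x⁻¹) < ⊤ := by
  have e : Ioi (0 : ℝ) = Real.exp '' univ := by rw [image_univ, Real.range_exp]
  rw [e, lintegral_image_eq_lintegral_abs_deriv_mul MeasurableSet.univ
    (fun x _ => (Real.hasDerivAt_exp x).hasDerivWithinAt) Real.exp_injective.injOn,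
    Measure.restrict_univ]
  refine lt_of_le_of_lt (lintegral_mono fun t => ?_)
    ((integrable_inv_one_add_sq.const_mul 32).lintegral_lt_top)
  rw [← ENNReal.ofReal_mul (logWeight_nonneg _), ← ENNReal.ofReal_mul (abs_nonneg _)]
  refine ENNReal.ofReal_le_ofReal ?_
  rw [abs_of_pos (Real.exp_pos t), logWeight, Real.log_exp]
  have : Real.exp t * (((1 + |t|) ^ 2)⁻¹ * (32 * (Real.exp t)⁻¹)) = 32 * ((1 + |t|) ^ 2)⁻¹ := by
    have := (Real.exp_pos t).ne'
    field_simp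
  rw [this]
  gcongr
  nlinarith [sq_abs t, abs_nonneg t]

theorem memLp_diffQuot_logLog :
    MemLp (diffQuot logLog) 2 ((volume : Measure (ℝ × ℝ)).restrict (Ioi 0 ×ˢ Ioi 0)) := by
  refine ⟨(measurable_diffQuot measurable_logLog).aestronglyMeasurable, ?_⟩
  rw [eLpNorm_two_eq]
  refine ENNReal.rpow_lt_top_of_nonneg (by norm_num) (ne_of_lt ?_)
  have hS1 : Measurable fun p : ℝ × ℝ =>
      ENNReal.ofReal (logKernel p) * ENNReal.ofReal (logWeight p.1) :=
    measurable_logKernel.ennreal_ofReal.mul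
      (measurable_logWeight.comp measurable_fst).ennreal_ofReal
  have hS2 : Measurable fun p : ℝ × ℝ =>
      ENNReal.ofReal (logKernel p) * ENNReal.ofReal (logWeight p.2) :=
    measurable_logKernel.ennreal_ofReal.mul
      (measurable_logWeight.comp measurable_snd).ennreal_ofReal
  set S : ℝ × ℝ → ℝ≥0∞ := fun p => ENNReal.ofReal (logKernel p) * ENNReal.ofReal (logWeight p.1) +
    ENNReal.ofReal (logKernel p) * ENNReal.ofReal (logWeight p.2) with hS
  have hSm : Measurable S := hS1.add hS2
  set m : Measure ℝ := volume.restrict (Ioi 0) with hm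
  have hQ : (volume : Measure (ℝ × ℝ)).restrict (Ioi 0 ×ˢ Ioi 0) = m.prod m := by
    rw [Measure.volume_eq_prod, ← Measure.prod_restrict]
  have hfin : ∫⁻ p, S p ∂(m.prod m) < ⊤ := by
    rw [hS, lintegral_add_left hS1, lintegral_prod _ hS1.aemeasurable,
      lintegral_prod_symm _ hS2.aemeasurable]
    refine ENNReal.add_lt_top.2 ⟨?_, ?_⟩
    · refine lt_of_le_of_lt (le_of_eq ?_) lintegral_logWeight_mul_inv_lt_top
      refine setLIntegral_congr_fun measurableSet_Ioi fun x hx => ?_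
      dsimp only
      rw [lintegral_mul_const' _ _ ENNReal.ofReal_ne_top, lintegral_logKernel_right hx, mul_comm]
    · refine lt_of_le_of_lt (le_of_eq ?_) lintegral_logWeight_mul_inv_lt_top
      refine setLIntegral_congr_fun measurableSet_Ioi fun x hx => ?_
      dsimp only
      rw [lintegral_mul_const' _ _ ENNReal.ofReal_ne_top, lintegral_logKernel_left hx, mul_comm]
  have hle : ∀ x y : ℝ, 0 < x → x < y → ‖diffQuot logLog (x, y)‖ₑ ^ 2 ≤ S (x, y) := by
    intro x y hx hxy
    rw [enorm_sq_eq_ofReal, hS]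
    dsimp only
    rw [← mul_add, ← ENNReal.ofReal_add (logWeight_nonneg _) (logWeight_nonneg _),
      ← ENNReal.ofReal_mul (logKernel_nonneg hx (hx.trans hxy))]
    exact ENNReal.ofReal_le_ofReal (diffQuot_logLog_sq_le hx hxy)
  calc ∫⁻ p in Ioi 0 ×ˢ Ioi 0, ‖diffQuot logLog p‖ₑ ^ 2
      ≤ ∫⁻ p in Ioi 0 ×ˢ Ioi 0, (S p + S p.swap) := by
        refine setLIntegral_mono (hSm.add (hSm.comp measurable_swap)) ?_
        rintro ⟨x, y⟩ ⟨hx, hy⟩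
        rcases lt_trichotomy x y with h | h | h
        · exact (hle x y hx h).trans le_self_add
        · simp [diffQuot, h]
        · have := (hle y x hy h).trans (le_add_self (b := S (x, y)))
          rwa [← diffQuot_swap] at this
    _ = ∫⁻ p, S p ∂(m.prod m) + ∫⁻ p, S p ∂(m.prod m) := by
        rw [hQ, lintegral_add_left hSm, lintegral_prod_swap]
    _ < ⊤ := ENNReal.add_lt_top.2 ⟨hfin, hfin⟩

theorem mem_Icc_of_logLog_lt {s c : ℝ} (hs : 0 < s) (h : logLog s < c) :
    s ∈ Icc (Real.exp (-Real.exp c)) (Real.exp (Real.exp c)) := by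
  have h1 : 1 + |Real.log s| < Real.exp c := (Real.log_lt_iff_lt_exp (by positivity)).1 h
  have h2 := abs_le.1 (show |Real.log s| ≤ Real.exp c by linarith)
  exact ⟨(Real.le_log_iff_exp_le hs).1 h2.1, (Real.log_le_iff_le_exp hs).1 h2.2⟩

theorem memLp_diffQuot_logLog_sub_right {a : ℝ} {E : Set ℝ} (hE : MeasurableSet E)
    (hEa : E ⊆ Ioi a) :
    MemLp (diffQuot fun x => logLog (x - a)) 2
      ((volume : Measure (ℝ × ℝ)).restrict (strip E)) := by
  have hQ : MeasurableSet (Ioi (0 : ℝ) ×ˢ Ioi (0 : ℝ)) := measurableSet_Ioi.prod measurableSet_Ioi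
  have h := ((memLp_indicator_iff_restrict hQ).2 memLp_diffQuot_logLog).comp_measurePreserving
    (measurePreserving_sub_right (volume : Measure (ℝ × ℝ)) (a, a))
  refine (h.mono_measure Measure.restrict_le_self).ae_eq ?_
  filter_upwards [ae_restrict_mem (measurableSet_strip hE)] with p hp
  have h1 : a < p.1 := hEa hp.1
  have h2 : a < p.2 := hEa hp.2.1
  rw [Function.comp_apply, indicator_of_mem (by constructor <;> simpa)]
  simp [diffQuot]

theorem memLp_diffQuot_logLog_sub_left {b : ℝ} {E : Set ℝ} (hE : MeasurableSet E)
    (hEb : E ⊆ Iio b) :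
    MemLp (diffQuot fun x => logLog (b - x)) 2
      ((volume : Measure (ℝ × ℝ)).restrict (strip E)) := by
  have hQ : MeasurableSet (Ioi (0 : ℝ) ×ˢ Ioi (0 : ℝ)) := measurableSet_Ioi.prod measurableSet_Ioi
  have h := (((memLp_indicator_iff_restrict hQ).2 memLp_diffQuot_logLog).comp_measurePreserving
    (Measure.measurePreserving_sub_left (volume : Measure (ℝ × ℝ)) (b, b))).neg
  refine (h.mono_measure Measure.restrict_le_self).ae_eq ?_
  filter_upwards [ae_restrict_mem (measurableSet_strip hE)] with p hp
  have h1 : p.1 < b := hEb hp.1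
  have h2 : p.2 < b := hEb hp.2.1
  rw [Pi.neg_apply, Function.comp_apply, indicator_of_mem (by constructor <;> simpa)]
  simp only [diffQuot, Prod.fst_sub, Prod.snd_sub]
  rw [← div_neg]
  congr 1
  ring

/-- Bounded open intervals and open half-lines. -/
def IsBoundedOrHalfLine (E : Set ℝ) : Prop :=
  (∃ a b : ℝ, a < b ∧ E = Ioo a b) ∨ (∃ b : ℝ, E = Iio b) ∨ ∃ a : ℝ, E = Ioi a

theorem IsBoundedOrHalfLine.isOpen {E : Set ℝ} (h : IsBoundedOrHalfLine E) : IsOpen E := by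
  rcases h with ⟨a, b, -, rfl⟩ | ⟨b, rfl⟩ | ⟨a, rfl⟩
  exacts [isOpen_Ioo, isOpen_Iio, isOpen_Ioi]

theorem IsBoundedOrHalfLine.nonempty {E : Set ℝ} (h : IsBoundedOrHalfLine E) : E.Nonempty := by
  rcases h with ⟨a, b, hab, rfl⟩ | ⟨b, rfl⟩ | ⟨a, rfl⟩
  exacts [nonempty_Ioo.2 hab, nonempty_Iio, nonempty_Ioi]

/-- There is a function of finite energy on `E` whose sublevel sets are relatively compact
in `E`. -/
theorem IsBoundedOrHalfLine.exists_exhaustion {E : Set ℝ} (hE : IsBoundedOrHalfLine E) :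
    ∃ h : ℝ → ℝ, Measurable h ∧
      MemLp (diffQuot h) 2 ((volume : Measure (ℝ × ℝ)).restrict (strip E)) ∧
      ∀ c, ∃ K ⊆ E, IsCompact K ∧ ∀ x ∈ E, h x < c → x ∈ K := by
  have hm := hE.isOpen.measurableSet
  rcases hE with ⟨a, b, -, rfl⟩ | ⟨b, rfl⟩ | ⟨a, rfl⟩
  · refine ⟨fun x => logLog (x - a) + logLog (b - x), ?_, ?_, fun c => ?_⟩
    · exact (measurable_logLog.comp (by fun_prop)).add (measurable_logLog.comp (by fun_prop))
    · rw [diffQuot_add]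
      exact (memLp_diffQuot_logLog_sub_right hm Ioo_subset_Ioi_self).add
        (memLp_diffQuot_logLog_sub_left hm Ioo_subset_Iio_self)
    · have := Real.exp_pos (-Real.exp c)
      refine ⟨Icc (a + Real.exp (-Real.exp c)) (b - Real.exp (-Real.exp c)),
        fun x hx => ⟨by linarith [hx.1], by linarith [hx.2]⟩, isCompact_Icc, fun x hx h => ?_⟩
      have h1 := mem_Icc_of_logLog_lt (sub_pos.2 hx.1)
        (show logLog (x - a) < c by linarith [logLog_nonneg (b - x)])
      have h2 := mem_Icc_of_logLog_lt (sub_pos.2 hx.2)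
        (show logLog (b - x) < c by linarith [logLog_nonneg (x - a)])
      exact ⟨by linarith [h1.1], by linarith [h2.1]⟩
  · refine ⟨fun x => logLog (b - x), measurable_logLog.comp (by fun_prop),
      memLp_diffQuot_logLog_sub_left hm Subset.rfl, fun c => ?_⟩
    have := Real.exp_pos (-Real.exp c)
    refine ⟨Icc (b - Real.exp (Real.exp c)) (b - Real.exp (-Real.exp c)),
      fun x hx => show x < b by linarith [hx.2], isCompact_Icc, fun x hx h => ?_⟩
    have h2 := mem_Icc_of_logLog_lt (sub_pos.2 hx) h
    exact ⟨by linarith [h2.2], by linarith [h2.1]⟩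
  · refine ⟨fun x => logLog (x - a), measurable_logLog.comp (by fun_prop),
      memLp_diffQuot_logLog_sub_right hm Subset.rfl, fun c => ?_⟩
    have := Real.exp_pos (-Real.exp c)
    refine ⟨Icc (a + Real.exp (-Real.exp c)) (a + Real.exp (Real.exp c)),
      fun x hx => show a < x by linarith [hx.1], isCompact_Icc, fun x hx h => ?_⟩
    have h2 := mem_Icc_of_logLog_lt (sub_pos.2 hx) h
    exact ⟨by linarith [h2.1], by linarith [h2.2]⟩

/-- The nearest point to `x` in the interval `[a, b]`. -/
noncomputable def clamp (a b x : ℝ) : ℝ := max a (min b x)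

theorem measurable_clamp (a b : ℝ) : Measurable (clamp a b) := by unfold clamp; fun_prop

theorem abs_clamp_sub_clamp_le (a b x y : ℝ) : |clamp a b x - clamp a b y| ≤ |x - y| := by
  unfold clamp
  rw [max_comm, max_comm a, min_comm, min_comm b]
  refine (abs_max_sub_max_le_abs _ _ _).trans ?_
  simpa using abs_min_sub_min_le_max x b y b

theorem clamp_mem_Icc {a b : ℝ} (hab : a ≤ b) (x : ℝ) : clamp a b x ∈ Icc a b :=
  ⟨le_max_left _ _, max_le hab (min_le_left _ _)⟩

theorem clamp_eq_self {a b x : ℝ} (hx : x ∈ Icc a b) : clamp a b x = x := by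
  rw [clamp, min_eq_right hx.2, max_eq_right hx.1]

theorem abs_diffQuot_le {u v : ℝ → ℝ} {p : ℝ × ℝ} (h : |u p.2 - u p.1| ≤ |v p.2 - v p.1|) :
    |diffQuot u p| ≤ |diffQuot v p| := by
  simp only [diffQuot, abs_div]; gcongr

theorem exists_of_tendsto_eLpNorm {α β : Type*} [MeasurableSpace α] [MeasurableSpace β]
    {μ : Measure α} {ν : Measure β} {F : ℕ → α → ℝ} {G : ℕ → β → ℝ} {p q : ℝ≥0∞}
    (hF : Tendsto (fun n => eLpNorm (F n) p μ) atTop (nhds 0))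
    (hG : Tendsto (fun n => eLpNorm (G n) q ν) atTop (nhds 0)) {δ : ℝ≥0∞} (hδ : 0 < δ) :
    ∃ n, eLpNorm (F n) p μ ≤ δ ∧ eLpNorm (G n) q ν ≤ δ :=
  ((hF.eventually_le_const hδ).and (hG.eventually_le_const hδ)).exists

theorem exists_bounded_approx {E I : Set ℝ} {g : ℝ → ℝ} (hg : Measurable g)
    (hD : MemLp (diffQuot g) 2 ((volume : Measure (ℝ × ℝ)).restrict (strip E)))
    (hI : IntegrableOn g I) {δ : ℝ≥0∞} (hδ : 0 < δ) :
    ∃ (M : ℝ) (v : ℝ → ℝ), Measurable v ∧ (∀ x, |v x| ≤ M) ∧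
      MemLp (diffQuot v) 2 ((volume : Measure (ℝ × ℝ)).restrict (strip E)) ∧
      eLpNorm (diffQuot g - diffQuot v) 2 ((volume : Measure (ℝ × ℝ)).restrict (strip E)) ≤ δ ∧
      eLpNorm (g - v) 1 (volume.restrict I) ≤ δ := by
  set v : ℕ → ℝ → ℝ := fun n x => clamp (-n) n (g x) with hv
  have hvm : ∀ n, Measurable (v n) := fun n => (measurable_clamp _ _).comp hg
  have hDv : ∀ n p, |diffQuot (v n) p| ≤ |diffQuot g p| := fun n p =>
    abs_diffQuot_le (abs_clamp_sub_clamp_le _ _ _ _)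
  have hev : ∀ x, ∀ᶠ n in atTop, v n x = g x := by
    intro x
    filter_upwards [eventually_ge_atTop ⌈|g x|⌉₊] with n hn
    exact clamp_eq_self (abs_le.1 (Nat.ceil_le.1 hn))
  have hvg : ∀ n x, |v n x| ≤ |g x| := by
    intro n x
    have h0 : clamp (-n) n 0 = 0 := clamp_eq_self (by simp)
    simpa [h0, hv] using abs_clamp_sub_clamp_le (-n : ℝ) n (g x) 0
  have t1 : Tendsto (fun n => eLpNorm (diffQuot g - diffQuot (v n)) 2
      ((volume : Measure (ℝ × ℝ)).restrict (strip E))) atTop (nhds 0) := by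
    refine tendsto_eLpNorm_sub_of_dominated (by norm_num) (by norm_num)
      (fun n => ((measurable_diffQuot hg).sub (measurable_diffQuot (hvm n))).aestronglyMeasurable)
      (hD.const_mul 2) (fun n => Eventually.of_forall fun p => ?_)
      (Eventually.of_forall fun p => ?_)
    · simp only [Pi.sub_apply, Real.norm_eq_abs, abs_mul, abs_two]
      exact (abs_sub _ _).trans (by linarith [hDv n p])
    · refine tendsto_const_nhds.congr' ?_
      filter_upwards [hev p.1, hev p.2] with n h1 h2
      simp [diffQuot, h1, h2]
  have t2 : Tendsto (fun n => eLpNorm (g - v n) 1 (volume.restrict I)) atTop (nhds 0) := by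
    refine tendsto_eLpNorm_sub_of_dominated (by norm_num) (by norm_num)
      (fun n => (hg.sub (hvm n)).aestronglyMeasurable)
      ((memLp_one_iff_integrable.2 hI).const_mul 2) (fun n => Eventually.of_forall fun x => ?_)
      (Eventually.of_forall fun x => ?_)
    · simp only [Pi.sub_apply, Real.norm_eq_abs, abs_mul, abs_two]
      exact (abs_sub _ _).trans (by linarith [hvg n x])
    · refine tendsto_const_nhds.congr' ?_
      filter_upwards [hev x] with n h1
      simp [h1]
  obtain ⟨n, h1, h2⟩ := exists_of_tendsto_eLpNorm t1 t2 hδ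
  refine ⟨n, v n, hvm n, fun x => abs_le.2 (clamp_mem_Icc (by simp) _), ?_, h1, h2⟩
  exact hD.mono (measurable_diffQuot (hvm n)).aestronglyMeasurable
    (Eventually.of_forall fun p => hDv n p)

theorem exists_compactlySupported_approx {E I : Set ℝ} (hE : IsBoundedOrHalfLine E)
    (hIE : I ⊆ E) (hIm : MeasurableSet I) (hIb : Bornology.IsBounded I) {v : ℝ → ℝ} {M : ℝ}
    (hv : Measurable v) (hvM : ∀ x, |v x| ≤ M)
    (hD : MemLp (diffQuot v) 2 ((volume : Measure (ℝ × ℝ)).restrict (strip E)))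
    {δ : ℝ≥0∞} (hδ : 0 < δ) :
    ∃ (u : ℝ → ℝ) (K : Set ℝ), Measurable u ∧ (∀ x, |u x| ≤ M) ∧ K ⊆ E ∧ IsCompact K ∧
      (∀ x ∉ K, u x = 0) ∧
      MemLp (diffQuot u) 2 ((volume : Measure (ℝ × ℝ)).restrict (strip E)) ∧
      eLpNorm (diffQuot v - diffQuot u) 2 ((volume : Measure (ℝ × ℝ)).restrict (strip E)) ≤ δ ∧
      eLpNorm (v - u) 1 (volume.restrict I) ≤ δ := by
  obtain ⟨h, hm, hh, hK⟩ := hE.exists_exhaustion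
  have hEm := hE.isOpen.measurableSet
  have hM : 0 ≤ M := (abs_nonneg _).trans (hvM 0)
  set c : ℕ → ℝ → ℝ := fun n x => clamp 0 1 (n + 1 - h x) with hc
  have hcm : ∀ n, Measurable (c n) := fun n => (measurable_clamp _ _).comp (by fun_prop)
  have hc01 : ∀ n x, c n x ∈ Icc (0 : ℝ) 1 := fun n x => clamp_mem_Icc zero_le_one _
  have hDc : ∀ n p, |diffQuot (c n) p| ≤ |diffQuot h p| := fun n p => by
    refine abs_diffQuot_le ((abs_clamp_sub_clamp_le _ _ _ _).trans (le_of_eq ?_))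
    rw [← abs_neg]; congr 1; ring
  have hcev : ∀ x, ∀ᶠ n in atTop, c n x = 1 := by
    intro x
    filter_upwards [eventually_ge_atTop ⌈h x⌉₊] with n hn
    have := Nat.ceil_le.1 hn
    change clamp 0 1 _ = 1
    rw [clamp, min_eq_left (by linarith), max_eq_right zero_le_one]
  set u : ℕ → ℝ → ℝ := fun n => E.indicator fun x => c n x * v x with hu
  have hum : ∀ n, Measurable (u n) := fun n => ((hcm n).mul hv).indicator hEm
  have huE : ∀ n, ∀ x ∈ E, u n x = c n x * v x := fun n x hx => indicator_of_mem hx _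
  have huv : ∀ n x, |u n x| ≤ |v x| := by
    intro n x
    by_cases hx : x ∈ E
    · rw [huE n x hx, abs_mul, abs_of_nonneg (hc01 n x).1]
      exact mul_le_of_le_one_left (abs_nonneg _) (hc01 n x).2
    · rw [hu]; dsimp only; rw [indicator_of_notMem hx, abs_zero]; exact abs_nonneg _
  have hbound : ∀ n, ∀ p ∈ strip E, |diffQuot v p - diffQuot (u n) p| ≤
      |diffQuot v p| + M * |diffQuot h p| := by
    intro n p hp
    have e : diffQuot v p - diffQuot (u n) p =
        (1 - c n p.1) * diffQuot v p - v p.2 * diffQuot (c n) p := by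
      simp only [diffQuot, huE n _ hp.1, huE n _ hp.2.1]; ring
    rw [e]
    refine (abs_sub _ _).trans (add_le_add ?_ ?_)
    · rw [abs_mul, abs_of_nonneg (sub_nonneg.2 (hc01 n p.1).2)]
      exact mul_le_of_le_one_left (abs_nonneg _) (by linarith [(hc01 n p.1).1])
    · rw [abs_mul]
      exact mul_le_mul (hvM _) (hDc n p) (abs_nonneg _) hM
  have hG : MemLp (fun p => |diffQuot v p| + M * |diffQuot h p|) 2
      ((volume : Measure (ℝ × ℝ)).restrict (strip E)) := hD.abs.add (hh.abs.const_mul M)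
  have hGn : ∀ n, ∀ᵐ p ∂((volume : Measure (ℝ × ℝ)).restrict (strip E)),
      ‖(diffQuot v - diffQuot (u n)) p‖ ≤ ‖|diffQuot v p| + M * |diffQuot h p|‖ := by
    intro n
    filter_upwards [ae_restrict_mem (measurableSet_strip hEm)] with p hp
    exact (hbound n p hp).trans (le_abs_self _)
  have hdm : ∀ n, AEStronglyMeasurable (diffQuot v - diffQuot (u n))
      ((volume : Measure (ℝ × ℝ)).restrict (strip E)) := fun n =>
    ((measurable_diffQuot hv).sub (measurable_diffQuot (hum n))).aestronglyMeasurable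
  have t1 : Tendsto (fun n => eLpNorm (diffQuot v - diffQuot (u n)) 2
      ((volume : Measure (ℝ × ℝ)).restrict (strip E))) atTop (nhds 0) := by
    refine tendsto_eLpNorm_sub_of_dominated (by norm_num) (by norm_num) hdm hG hGn ?_
    filter_upwards [ae_restrict_mem (measurableSet_strip hEm)] with p hp
    refine tendsto_const_nhds.congr' ?_
    filter_upwards [hcev p.1, hcev p.2] with n h1 h2
    simp [diffQuot, huE n _ hp.1, huE n _ hp.2.1, h1, h2]
  have hvI : MemLp v 1 (volume.restrict I) := by
    have : IsFiniteMeasure (volume.restrict I) := ⟨by simpa using hIb.measure_lt_top⟩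
    exact MemLp.of_bound hv.aestronglyMeasurable M (Eventually.of_forall hvM)
  have t2 : Tendsto (fun n => eLpNorm (v - u n) 1 (volume.restrict I)) atTop (nhds 0) := by
    refine tendsto_eLpNorm_sub_of_dominated (by norm_num) (by norm_num)
      (fun n => (hv.sub (hum n)).aestronglyMeasurable)
      (hvI.const_mul 2) (fun n => Eventually.of_forall fun x => ?_) ?_
    · simp only [Pi.sub_apply, Real.norm_eq_abs, abs_mul, abs_two]
      exact (abs_sub _ _).trans (by linarith [huv n x])
    · filter_upwards [ae_restrict_mem hIm] with x hx
      refine tendsto_const_nhds.congr' ?_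
      filter_upwards [hcev x] with n h1
      simp [huE n x (hIE hx), h1]
  obtain ⟨n, h1, h2⟩ := exists_of_tendsto_eLpNorm t1 t2 hδ
  obtain ⟨K, hKE, hKc, hKx⟩ := hK (n + 1)
  refine ⟨u n, K, hum n, fun x => (huv n x).trans (hvM x), hKE, hKc, fun x hx => ?_, ?_, h1, h2⟩
  · by_cases hxE : x ∈ E
    · have : (n : ℝ) + 1 ≤ h x := not_lt.1 fun hlt => hx (hKx x hxE hlt)
      rw [huE n x hxE, hc]
      dsimp only
      rw [clamp, max_eq_left ((min_le_right _ _).trans (by linarith)), zero_mul]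
    · exact indicator_of_notMem hxE _
  · have := hD.sub (hG.mono (hdm n) (hGn n))
    rwa [sub_sub_cancel] at this

/-- Minkowski's integral inequality for averages with respect to a probability measure. -/
theorem eLpNorm_lintegral_le {T X : Type*} [MeasurableSpace T] [MeasurableSpace X]
    {m : Measure T} [IsProbabilityMeasure m] {μ : Measure X} [SFinite μ] {p : ℝ≥0∞} (hp1 : 1 ≤ p)
    (hp : p ≠ ⊤) {F : T → X → ℝ≥0∞} (hF : Measurable (Function.uncurry F)) {δ : ℝ≥0∞}
    (h : ∀ᵐ t ∂m, eLpNorm (F t) p μ ≤ δ) :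
    eLpNorm (fun x => ∫⁻ t, F t x ∂m) p μ ≤ δ := by
  have hp0 : p ≠ 0 := (zero_lt_one.trans_le hp1).ne'
  have hpos : 0 < p.toReal := ENNReal.toReal_pos hp0 hp
  rw [eLpNorm_eq_lintegral_rpow_enorm_toReal hp0 hp, one_div, ENNReal.rpow_inv_le_iff hpos]
  have jensen : ∀ x, (∫⁻ t, F t x ∂m) ^ p.toReal ≤ ∫⁻ t, F t x ^ p.toReal ∂m := by
    intro x
    have hx : Measurable fun t => F t x := hF.comp measurable_prodMk_right
    have := eLpNorm_le_eLpNorm_of_exponent_le (μ := m) hp1 hx.aestronglyMeasurable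
    rw [eLpNorm_one_eq_lintegral_enorm, eLpNorm_eq_lintegral_rpow_enorm_toReal hp0 hp, one_div,
      ENNReal.le_rpow_inv_iff hpos] at this
    simpa using this
  calc ∫⁻ x, ‖∫⁻ t, F t x ∂m‖ₑ ^ p.toReal ∂μ
      ≤ ∫⁻ x, ∫⁻ t, F t x ^ p.toReal ∂m ∂μ := lintegral_mono fun x => by simpa using jensen x
    _ = ∫⁻ t, ∫⁻ x, F t x ^ p.toReal ∂μ ∂m :=
        lintegral_lintegral_swap ((hF.pow_const _).comp measurable_swap).aemeasurable
    _ ≤ ∫⁻ _, δ ^ p.toReal ∂m := by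
        refine lintegral_mono_ae ?_
        filter_upwards [h] with t ht
        rw [eLpNorm_eq_lintegral_rpow_enorm_toReal hp0 hp, one_div,
          ENNReal.rpow_inv_le_iff hpos] at ht
        simpa using ht
    _ = δ ^ p.toReal := by simp

theorem eLpNorm_integral_mul_le {X : Type*} [MeasurableSpace X] {μ : Measure X} [SFinite μ]
    {p : ℝ≥0∞} (hp1 : 1 ≤ p) (hp : p ≠ ⊤) {ρ : ℝ → ℝ} (hρ : Measurable ρ)
    (hρ1 : ∫⁻ t, ‖ρ t‖ₑ = 1) {W : ℝ → X → ℝ} (hW : Measurable (Function.uncurry W)) {δ : ℝ≥0∞}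
    (h : ∀ t, ρ t ≠ 0 → eLpNorm (W t) p μ ≤ δ) :
    eLpNorm (fun x => ∫ t, ρ t * W t x) p μ ≤ δ := by
  set m : Measure ℝ := volume.withDensity fun t => ‖ρ t‖ₑ
  have : IsProbabilityMeasure m := ⟨by simpa [m] using hρ1⟩
  refine le_trans (eLpNorm_mono_enorm (g := fun x => ∫⁻ t, ‖W t x‖ₑ ∂m) fun x => ?_)
    (eLpNorm_lintegral_le (m := m) hp1 hp (F := fun t x => ‖W t x‖ₑ) hW.enorm ?_)
  · refine (enorm_integral_le_lintegral_enorm _).trans (le_of_eq ?_)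
    have hx : Measurable fun t => W t x := hW.comp measurable_prodMk_right
    rw [enorm_eq_self, lintegral_withDensity_eq_lintegral_mul _ hρ.enorm hx.enorm]
    simp [enorm_mul]
  · rw [ae_withDensity_iff hρ.enorm]
    refine Eventually.of_forall fun t ht => ?_
    simpa [eLpNorm_enorm] using h t (by simpa using ht)

/-- A bounded function vanishing off a compact subset of `E` and of finite energy on `E` has
finite energy on the whole line. -/
theorem memLp_indicator_strip_univ {E K : Set ℝ} (hE : IsOpen E) (hK : IsCompact K) (hKE : K ⊆ E)
    {u : ℝ → ℝ} {M : ℝ} (hu : Measurable u) (huM : ∀ x, |u x| ≤ M) (huK : ∀ x ∉ K, u x = 0)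
    (hD : MemLp (diffQuot u) 2 ((volume : Measure (ℝ × ℝ)).restrict (strip E))) :
    MemLp ((strip univ).indicator (diffQuot u)) 2 (volume : Measure (ℝ × ℝ)) := by
  obtain ⟨d, hd, hdE⟩ := hK.exists_cthickening_subset_open hE hKE
  have hM : 0 ≤ M := (abs_nonneg _).trans (huM 0)
  set B : Set (ℝ × ℝ) := Metric.cthickening 1 K ×ˢ Metric.cthickening 1 K with hB
  have hBc : IsCompact B := hK.cthickening.prod hK.cthickening
  have h1 := (memLp_indicator_iff_restrict (measurableSet_strip hE.measurableSet)).2 hD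
  have h2 : MemLp (B.indicator fun _ => 2 * M / d) 2 (volume : Measure (ℝ × ℝ)) :=
    memLp_indicator_const 2 hBc.measurableSet _ (Or.inr hBc.measure_lt_top.ne)
  refine (h1.abs.add h2).mono
    ((measurable_diffQuot hu).indicator (measurableSet_strip MeasurableSet.univ)).aestronglyMeasurable
    (Eventually.of_forall fun p => ?_)
  have nB : 0 ≤ B.indicator (fun _ => 2 * M / d) p := indicator_apply_nonneg fun _ => by positivity
  have n1 := abs_nonneg ((strip E).indicator (diffQuot u) p)
  change |_| ≤ |(|(strip E).indicator (diffQuot u) p| + B.indicator (fun _ => 2 * M / d) p)|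
  rw [abs_of_nonneg (add_nonneg n1 nB)]
  by_cases hp : p ∈ strip univ
  swap
  · rw [indicator_of_notMem hp, abs_zero]; positivity
  rw [indicator_of_mem hp]
  by_cases hpK : p.1 ∈ K ∨ p.2 ∈ K
  swap
  · rw [not_or] at hpK
    rw [diffQuot, huK _ hpK.1, huK _ hpK.2, sub_zero, zero_div, abs_zero]
    positivity
  have thick : ∀ r, 0 ≤ r → |p.2 - p.1| ≤ r →
      p.1 ∈ Metric.cthickening r K ∧ p.2 ∈ Metric.cthickening r K := by
    intro r hr hpr
    rcases hpK with h | h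
    · exact ⟨Metric.self_subset_cthickening K h,
        Metric.mem_cthickening_of_dist_le _ _ _ _ h (by rwa [Real.dist_eq])⟩
    · exact ⟨Metric.mem_cthickening_of_dist_le _ _ _ _ h (by rwa [Real.dist_eq, abs_sub_comm]),
        Metric.self_subset_cthickening K h⟩
  by_cases hpd : |p.2 - p.1| ≤ d
  · have := thick d hd.le hpd
    rw [indicator_of_mem (s := strip E) ⟨hdE this.1, hdE this.2, hp.2.2⟩]
    linarith
  · rw [indicator_of_mem (s := B) (thick 1 zero_le_one hp.2.2.le)]
    have : |diffQuot u p| ≤ 2 * M / d := by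
      rw [diffQuot, abs_div]
      refine div_le_div₀ (by positivity) ?_ hd (not_le.1 hpd).le
      exact (abs_sub _ _).trans (by linarith [huM p.1, huM p.2])
    linarith

theorem exists_smooth_approx {E I K : Set ℝ} (hE : IsOpen E) (hK : IsCompact K) (hKE : K ⊆ E)
    {u : ℝ → ℝ} {M : ℝ} (hu : Measurable u) (huM : ∀ x, |u x| ≤ M) (huK : ∀ x ∉ K, u x = 0)
    (hD : MemLp (diffQuot u) 2 ((volume : Measure (ℝ × ℝ)).restrict (strip E)))
    {δ : ℝ≥0∞} (hδ : 0 < δ) :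
    ∃ φ : ℝ → ℝ, ContDiff ℝ (⊤ : ℕ∞) φ ∧ HasCompactSupport φ ∧ tsupport φ ⊆ E ∧
      eLpNorm (diffQuot φ - diffQuot u) 2 ((volume : Measure (ℝ × ℝ)).restrict (strip E)) ≤ δ ∧
      eLpNorm (φ - u) 1 (volume.restrict I) ≤ δ := by
  have hF := memLp_indicator_strip_univ hE hK hKE hu huM huK hD
  set F := (strip univ).indicator (diffQuot u) with hFdef
  have huc : HasCompactSupport u := HasCompactSupport.intro hK huK
  have huL : MemLp u 1 volume := by
    have h1 : MemLp (K.indicator fun _ => M) 1 (volume : Measure ℝ) :=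
      memLp_indicator_const 1 hK.measurableSet _ (Or.inr hK.measure_lt_top.ne)
    refine h1.mono hu.aestronglyMeasurable (Eventually.of_forall fun x => ?_)
    by_cases hx : x ∈ K
    · rw [indicator_of_mem hx]; exact (huM x).trans (le_abs_self M)
    · rw [huK x hx, norm_zero]; exact norm_nonneg _
  obtain ⟨d, hd, hdE⟩ := hK.exists_cthickening_subset_open hE hKE
  have : Fact ((2 : ℝ≥0∞) ≠ ⊤) := ⟨by norm_num⟩
  have : Fact ((1 : ℝ≥0∞) ≠ ⊤) := ⟨by norm_num⟩
  have c1 : Tendsto (fun t : ℝ => ((-t, -t) : ℝ × ℝ)) (nhds 0) (nhds 0) := by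
    have : Continuous fun t : ℝ => ((-t, -t) : ℝ × ℝ) := by fun_prop
    simpa only [neg_zero, Prod.mk_zero_zero] using this.tendsto 0
  have c2 : Tendsto (fun t : ℝ => -t) (nhds 0) (nhds 0) := by
    simpa using (continuous_neg (G := ℝ)).tendsto 0
  have t1 := ((tendsto_eLpNorm_translate_sub hF).comp c1).eventually_le_const hδ
  have t2 := ((tendsto_eLpNorm_translate_sub huL).comp c2).eventually_le_const hδ
  obtain ⟨r, hr, hrt⟩ := Metric.eventually_nhds_iff.1 (t1.and t2)
  set s := min r d with hs
  have hs0 : 0 < s := lt_min hr hd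
  let b : ContDiffBump (0 : ℝ) := ⟨s / 2, s, by positivity, by linarith⟩
  set ρ := b.normed volume with hρ
  have hρc : Continuous ρ := b.continuous_normed
  have hρi : Integrable ρ := b.integrable_normed
  have hρs : ∀ t, ρ t ≠ 0 → |t| < s := by
    intro t ht
    have : t ∈ Function.support ρ := ht
    rw [hρ, b.support_normed_eq] at this
    simpa using this
  have hρ1 : ∫⁻ t, ‖ρ t‖ₑ = 1 := by
    have : ∀ t, ‖ρ t‖ₑ = ENNReal.ofReal (ρ t) := fun t =>
      Real.enorm_of_nonneg (b.nonneg_normed t)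
    simp_rw [this]
    rw [← ofReal_integral_eq_lintegral_ofReal hρi (Eventually.of_forall b.nonneg_normed),
      b.integral_normed, ENNReal.ofReal_one]
  set φ := convolution ρ u (ContinuousLinearMap.lsmul ℝ ℝ) volume with hφ
  have hφx : ∀ x, φ x = ∫ t, ρ t * u (x - t) := fun x => rfl
  have hint : ∀ x, Integrable fun t => ρ t * u (x - t) := fun x =>
    hρi.mul_bdd (c := M) (hu.comp (measurable_id.const_sub x)).aestronglyMeasurable
      (Eventually.of_forall fun t => huM (x - t))
  have hconst : ∀ a : ℝ, ∫ t, ρ t * a = a := fun a => by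
    rw [integral_mul_const, b.integral_normed, one_mul]
  refine ⟨φ, ?_, ?_, ?_, ?_, ?_⟩
  · exact b.hasCompactSupport_normed.contDiff_convolution_left _ b.contDiff_normed
      (memLp_one_iff_integrable.1 huL).locallyIntegrable
  · exact b.hasCompactSupport_normed.convolution _ huc
  · refine (closure_minimal ?_ Metric.isClosed_cthickening).trans hdE
    refine (support_convolution_subset _).trans ?_
    rintro x ⟨t, ht, y, hy, rfl⟩
    refine Metric.mem_cthickening_of_dist_le _ y _ _ (by_contra fun h => hy (huK y h)) ?_
    rw [Real.dist_eq, add_sub_cancel_right]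
    exact (hρs t ht).le.trans (min_le_right _ _)
  · have e : diffQuot φ - diffQuot u = fun p => ∫ t, ρ t *
        (diffQuot u (p.1 - t, p.2 - t) - diffQuot u p) := by
      ext p
      have e1 : ∀ t, ρ t * (diffQuot u (p.1 - t, p.2 - t) - diffQuot u p) =
          (ρ t * u (p.2 - t) - ρ t * u (p.1 - t)) / (p.2 - p.1) - ρ t * diffQuot u p := by
        intro t
        simp only [diffQuot, sub_sub_sub_cancel_right]
        ring
      simp_rw [e1]
      have hi : Integrable fun t =>
          (ρ t * u (p.2 - t) - ρ t * u (p.1 - t)) / (p.2 - p.1) :=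
        ((hint _).sub (hint _)).div_const _
      rw [integral_sub hi (hρi.mul_const _), hconst, integral_div,
        integral_sub (hint _) (hint _), ← hφx, ← hφx]
      rfl
    rw [e]
    refine eLpNorm_integral_mul_le (by norm_num) (by norm_num) hρc.measurable hρ1
      (W := fun t p => diffQuot u (p.1 - t, p.2 - t) - diffQuot u p) ?_ fun t ht => ?_
    · exact ((measurable_diffQuot hu).comp
        (f := fun q : ℝ × ℝ × ℝ => ((q.2.1 - q.1, q.2.2 - q.1) : ℝ × ℝ)) (by fun_prop)).sub
        ((measurable_diffQuot hu).comp measurable_snd)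
    · refine le_trans ?_ (hrt (y := t) (by simpa using (hρs t ht).trans_le (min_le_left _ _))).1
      refine le_trans (le_of_eq ?_) (eLpNorm_mono_measure _ (Measure.restrict_le_self (s := strip E)))
      refine eLpNorm_congr_ae ?_
      filter_upwards [ae_restrict_mem (measurableSet_strip hE.measurableSet)] with p hp
      have h1 : p ∈ strip univ := ⟨trivial, trivial, hp.2.2⟩
      have h2 : ((-t, -t) : ℝ × ℝ) + p ∈ strip univ :=
        ⟨trivial, trivial, by simpa using hp.2.2⟩
      rw [hFdef, indicator_of_mem h1, indicator_of_mem h2]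
      congr 2
      ext <;> simp [sub_eq_neg_add]
  · have e : φ - u = fun x => ∫ t, ρ t * (u (x - t) - u x) := by
      ext x
      simp_rw [mul_sub]
      rw [integral_sub (hint _) (hρi.mul_const _), hconst, ← hφx]
      rfl
    rw [e]
    refine eLpNorm_integral_mul_le le_rfl (by norm_num) hρc.measurable hρ1
      (W := fun t x => u (x - t) - u x) ?_ fun t ht => ?_
    · exact (hu.comp (f := fun q : ℝ × ℝ => q.2 - q.1) (by fun_prop)).sub
        (hu.comp measurable_snd)
    · refine le_trans ?_ (hrt (y := t) (by simpa using (hρs t ht).trans_le (min_le_left _ _))).2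
      refine le_trans (le_of_eq ?_) (eLpNorm_mono_measure _ (Measure.restrict_le_self (s := I)))
      simp_rw [sub_eq_neg_add _ t]

theorem LocIntOn.aemeasurable {E : Set ℝ} {f : ℝ → ℝ} (hf : LocIntOn E f) (hE : MeasurableSet E) :
    AEMeasurable f (volume.restrict E) := by
  have h : ⋃ n : ℕ, Icc (-n : ℝ) n = univ := iUnion_eq_univ_iff.2 fun x => by
    obtain ⟨n, hn⟩ := exists_nat_ge |x|
    exact ⟨n, abs_le.1 hn⟩
  have e : E = ⋃ n : ℕ, E ∩ Icc (-n : ℝ) n := by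
    rw [← inter_iUnion, h, inter_univ]
  rw [e, aemeasurable_iUnion_iff]
  exact fun n => (hf _ inter_subset_left (hE.inter measurableSet_Icc)
    ((Metric.isBounded_Icc _ _).subset inter_subset_right)).aemeasurable

theorem eLpNorm_sub_le_three {α : Type*} [MeasurableSpace α] {μ : Measure α} {p : ℝ≥0∞}
    (hp : 1 ≤ p) {a b c d : α → ℝ} (ha : Measurable a) (hb : Measurable b) (hc : Measurable c)
    (hd : Measurable d) {δ : ℝ≥0∞} (h1 : eLpNorm (a - b) p μ ≤ δ) (h2 : eLpNorm (b - c) p μ ≤ δ)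
    (h3 : eLpNorm (d - c) p μ ≤ δ) : eLpNorm (a - d) p μ ≤ 3 * δ := by
  have e : a - d = (a - b) + ((b - c) + (c - d)) := by abel
  rw [eLpNorm_sub_comm] at h3
  rw [e]
  calc _ ≤ eLpNorm (a - b) p μ + (eLpNorm (b - c) p μ + eLpNorm (c - d) p μ) :=
        (eLpNorm_add_le (ha.sub hb).aestronglyMeasurable
          ((hb.sub hc).add (hc.sub hd)).aestronglyMeasurable hp).trans
          (add_le_add le_rfl (eLpNorm_add_le (hb.sub hc).aestronglyMeasurable
            (hc.sub hd).aestronglyMeasurable hp))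
    _ ≤ δ + (δ + δ) := add_le_add h1 (add_le_add h2 h3)
    _ = 3 * δ := by ring

theorem ofReal_abs_avgOn_le (J : Set ℝ) (w : ℝ → ℝ) :
    ENNReal.ofReal |avgOn J w| ≤
      ENNReal.ofReal (volume J).toReal⁻¹ * eLpNorm w 1 (volume.restrict J) := by
  rw [avgOn, abs_mul, abs_of_nonneg (by positivity), ENNReal.ofReal_mul (by positivity),
    eLpNorm_one_eq_lintegral_enorm]
  gcongr
  rw [← Real.enorm_eq_ofReal_abs]
  exact enorm_integral_le_lintegral_enorm _

theorem avgOn_congr_ae {J : Set ℝ} {u v : ℝ → ℝ} (h : u =ᵐ[volume.restrict J] v) :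
    avgOn J u = avgOn J v := by
  rw [avgOn, avgOn, integral_congr_ae h]

theorem exists_testFunction_approx {E I : Set ℝ} (hE : IsBoundedOrHalfLine E) (hIE : I ⊆ E)
    (hIm : MeasurableSet I) (hIb : Bornology.IsBounded I) {f : ℝ → ℝ} (hf : LocIntOn E f)
    (hfin : screenedSeminorm E 1 f < ⊤) {δ : ℝ} (hδ : 0 < δ) :
    ∃ φ : ℝ → ℝ, ContDiff ℝ (⊤ : ℕ∞) φ ∧ HasCompactSupport φ ∧ tsupport φ ⊆ E ∧
      screenedSeminorm E 1 (fun x => f x - φ x) ≤ ENNReal.ofReal δ ∧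
      ENNReal.ofReal |avgOn I (fun x => f x - φ x)| ≤ ENNReal.ofReal δ := by
  have hEm := hE.isOpen.measurableSet
  have hfm := hf.aemeasurable hEm
  set g := hfm.mk f
  have hg : Measurable g := hfm.measurable_mk
  have hfg : f =ᵐ[volume.restrict E] g := hfm.ae_eq_mk
  have hfgI : f =ᵐ[volume.restrict I] g := ae_restrict_of_ae_restrict_of_subset hIE hfg
  have hD : MemLp (diffQuot g) 2 ((volume : Measure (ℝ × ℝ)).restrict (strip E)) := by
    refine ⟨(measurable_diffQuot hg).aestronglyMeasurable, ?_⟩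
    rwa [← screenedSeminorm_eq_eLpNorm hEm hg, ← screenedSeminorm_congr_ae hfg]
  set c := (volume I).toReal⁻¹
  have hc : 0 ≤ c := by positivity
  set η := δ / (3 * (1 + c))
  have hη : 0 < ENNReal.ofReal η := ENNReal.ofReal_pos.2 (by positivity)
  have h3η : 3 * ENNReal.ofReal η = ENNReal.ofReal (3 * η) := by
    rw [ENNReal.ofReal_mul (by norm_num)]; norm_num
  have h3 : (1 + c) * (3 * η) = δ := by simp only [η]; field_simp
  obtain ⟨M, v, hv, hvM, hvD, v1, v2⟩ :=
    exists_bounded_approx hg hD ((hf I hIE hIm hIb).congr_fun_ae hfgI) hη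
  obtain ⟨u, K, hu, huM, hKE, hK, huK, huD, u1, u2⟩ :=
    exists_compactlySupported_approx hE hIE hIm hIb hv hvM hvD hη
  obtain ⟨φ, hφ, hφc, hφE, φ1, φ2⟩ :=
    exists_smooth_approx (I := I) hE.isOpen hK hKE hu huM huK huD hη
  have hφm : Measurable φ := hφ.continuous.measurable
  refine ⟨φ, hφ, hφc, hφE, ?_, ?_⟩
  · have h1 : (fun x => f x - φ x) =ᵐ[volume.restrict E] g - φ := hfg.sub (ae_eq_refl φ)
    rw [screenedSeminorm_congr_ae h1, screenedSeminorm_eq_eLpNorm hEm (hg.sub hφm),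
      show diffQuot (g - φ) = diffQuot g - diffQuot φ from diffQuot_sub g φ]
    refine (eLpNorm_sub_le_three (by norm_num) (measurable_diffQuot hg) (measurable_diffQuot hv)
      (measurable_diffQuot hu) (measurable_diffQuot hφm) v1 u1 φ1).trans ?_
    rw [h3η]
    refine ENNReal.ofReal_le_ofReal ?_
    nlinarith [show 0 < η by positivity]
  · have h2 : (fun x => f x - φ x) =ᵐ[volume.restrict I] g - φ := hfgI.sub (ae_eq_refl φ)
    rw [avgOn_congr_ae h2]
    refine (ofReal_abs_avgOn_le I _).trans ?_
    refine (mul_le_mul_right (eLpNorm_sub_le_three le_rfl hg hv hu hφm v2 u2 φ2) _).trans ?_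
    rw [h3η, ← ENNReal.ofReal_mul hc]
    refine ENNReal.ofReal_le_ofReal ?_
    nlinarith [show 0 < η by positivity]

namespace GammaConfig

variable {N : ℕ} (cfg : GammaConfig N)

theorem isBoundedOrHalfLine (j : Fin (N + 1)) : IsBoundedOrHalfLine (cfg.E j) := by
  rcases cfg.hE j with h | ⟨-, h⟩ | ⟨-, h⟩
  exacts [Or.inl h, Or.inr (Or.inl h), Or.inr (Or.inr h)]

theorem lt_of_mem_of_mem {i j : Fin (N + 1)} (hij : i < j) {x y : ℝ} (hx : x ∈ cfg.E i)
    (hy : y ∈ cfg.E j) : x < y := by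
  induction j using Fin.induction generalizing y with
  | zero => exact absurd hij (Fin.not_lt_zero i)
  | succ j ih =>
    obtain ⟨c, d, hcd, hc, hd⟩ := cfg.hsep j
    rcases (Fin.le_castSucc_iff.2 hij).lt_or_eq with h | h
    · obtain ⟨z, hz⟩ := (cfg.isBoundedOrHalfLine j.castSucc).nonempty
      linarith [ih h hz, hc z hz, hd y hy]
    · rw [h] at hx
      linarith [hc x hx, hd y hy]

theorem eq_of_mem_of_mem {i j : Fin (N + 1)} {x : ℝ} (hi : x ∈ cfg.E i) (hj : x ∈ cfg.E j) :
    i = j := by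
  rcases lt_trichotomy i j with h | h | h
  · exact absurd (cfg.lt_of_mem_of_mem h hi hj) (lt_irrefl x)
  · exact h
  · exact absurd (cfg.lt_of_mem_of_mem h hj hi) (lt_irrefl x)

theorem seminorm_le {w : ℝ → ℝ} {δ : ℝ≥0∞} (h1 : ∀ j, screenedSeminorm (cfg.E j) 1 w ≤ δ)
    (h2 : ∀ j, ENNReal.ofReal |avgOn (cfg.I j) w| ≤ δ) :
    cfg.seminorm w ≤ (3 * N + 1 : ℕ) * δ := by
  have hs : ∀ j : Fin N,
      ENNReal.ofReal |avgOn (cfg.I j.succ) w - avgOn (cfg.I j.castSucc) w| ≤ δ + δ := fun j =>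
    (ENNReal.ofReal_le_ofReal (abs_sub _ _)).trans <|
      ENNReal.ofReal_add_le.trans (add_le_add (h2 _) (h2 _))
  calc cfg.seminorm w ≤ ∑ _j : Fin (N + 1), δ + ∑ _j : Fin N, (δ + δ) :=
        add_le_add (Finset.sum_le_sum fun j _ => h1 j) (Finset.sum_le_sum fun j _ => hs j)
    _ = (3 * N + 1 : ℕ) * δ := by
        simp only [Finset.sum_const, Finset.card_univ, Fintype.card_fin, nsmul_eq_mul]
        push_cast
        ring

end GammaConfig

/-- density of `C_c^∞(Γ^D)` in `Ḣ^{1/2}(Γ^D)`: for every locally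
integrable `f` on `Γ^D` with `|f|_{Ḣ^{1/2}(Γ^D)} < ∞` and every `ε > 0` there is a
smooth `φ` with compact support contained in the open set `Γ^D` such that
`|f − φ|_{Ḣ^{1/2}(Γ^D)} < ε`. -/
theorem statement17 {N : ℕ} (cfg : GammaConfig N) (f : ℝ → ℝ)
    (hf : LocIntOn cfg.Gamma f) (hfin : cfg.seminorm f < ⊤) (ε : ℝ) (hε : 0 < ε) :
    ∃ φ : ℝ → ℝ, ContDiff ℝ (⊤ : ℕ∞) φ ∧ HasCompactSupport φ ∧
      tsupport φ ⊆ cfg.Gamma ∧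
      cfg.seminorm (fun x => f x - φ x) < ENNReal.ofReal ε := by
  have hEm : ∀ j, MeasurableSet (cfg.E j) := fun j => (cfg.isBoundedOrHalfLine j).isOpen.measurableSet
  have hIm : ∀ j, MeasurableSet (cfg.I j) := fun j => by
    obtain ⟨a, b, -, h⟩ := cfg.hIint j
    exact h ▸ measurableSet_Ioo
  have hIb : ∀ j, Bornology.IsBounded (cfg.I j) := fun j => by
    obtain ⟨a, b, -, h⟩ := cfg.hIint j
    exact h ▸ Metric.isBounded_Ioo a b
  have hfE : ∀ j, LocIntOn (cfg.E j) f := fun j s hs =>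
    hf s (hs.trans (subset_iUnion cfg.E j))
  have hsum : ∑ j, screenedSeminorm (cfg.E j) 1 f < ⊤ := lt_of_le_of_lt le_self_add hfin
  have hEfin : ∀ j, screenedSeminorm (cfg.E j) 1 f < ⊤ := fun j =>
    ENNReal.sum_lt_top.1 hsum j (Finset.mem_univ j)
  set δ := ε / (3 * N + 2)
  have hδ : 0 < δ := by positivity
  choose ψ hψ hψc hψE hψ1 hψ2 using fun j => exists_testFunction_approx
    (cfg.isBoundedOrHalfLine j) (cfg.hIsub j) (hIm j) (hIb j) (hfE j) (hEfin j) hδ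
  have hψ0 : ∀ j, ∀ x ∈ cfg.E j, ∑ i, ψ i x = ψ j x := fun j x hx =>
    Finset.sum_eq_single j
      (fun i _ hij => image_eq_zero_of_notMem_tsupport fun h =>
        hij (cfg.eq_of_mem_of_mem (hψE i h) hx))
      (fun h => absurd (Finset.mem_univ j) h)
  have hsupp : Function.support (fun x => ∑ i, ψ i x) ⊆ ⋃ i, tsupport (ψ i) := by
    intro x hx
    obtain ⟨i, -, hi⟩ := Finset.exists_ne_zero_of_sum_ne_zero hx
    exact mem_iUnion.2 ⟨i, subset_tsupport _ hi⟩
  have hcomp : IsCompact (⋃ i, tsupport (ψ i)) := isCompact_iUnion hψc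
  have htsupp : tsupport (fun x => ∑ i, ψ i x) ⊆ ⋃ i, tsupport (ψ i) :=
    closure_minimal hsupp hcomp.isClosed
  refine ⟨fun x => ∑ i, ψ i x, ContDiff.sum fun i _ => hψ i,
    hcomp.of_isClosed_subset (isClosed_tsupport _) htsupp,
    htsupp.trans (iUnion_mono hψE), ?_⟩
  have hcongr : ∀ j, (fun x => f x - ∑ i, ψ i x) =ᵐ[volume.restrict (cfg.E j)]
      fun x => f x - ψ j x := fun j => by
    filter_upwards [ae_restrict_mem (hEm j)] with x hx
    rw [hψ0 j x hx]
  refine lt_of_le_of_lt (cfg.seminorm_le (δ := ENNReal.ofReal δ) (fun j => ?_) fun j => ?_) ?_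
  · rw [screenedSeminorm_congr_ae (hcongr j)]
    exact hψ1 j
  · rw [avgOn_congr_ae (ae_restrict_of_ae_restrict_of_subset (cfg.hIsub j) (hcongr j))]
    exact hψ2 j
  · rw [← ENNReal.ofReal_natCast, ← ENNReal.ofReal_mul (by positivity)]
    refine (ENNReal.ofReal_lt_ofReal_iff hε).2 ?_
    have : (3 * N + 2) * δ = ε := by simp only [δ]; field_simp
    push_cast
    linarith
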